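/- There are no integers q, a₂, a₃, b₂, b₃ satisfying |a₂a₃ + b₂b₃| = 8 and a₂² + a₃² + b₂² + b₃² = 6(q² + 1). -/

import Mathlib

theorem ZMod.sq_eq_of_sixteen (x : ZMod 16) : x ^ 2 = 0 ∨ x ^ 2 = 1 ∨ x ^ 2 = 4 ∨ x ^ 2 = 9 := by
  revert x
  decide

theorem ZMod.sq_add_sq_ne_six_mul_sq_add_one (x y q : ZMod 16) :
    x ^ 2 + y ^ 2 ≠ 6 * (q ^ 2 + 1) := by
  rcases ZMod.sq_eq_of_sixteen x with hx | hx | hx | hx <;>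
  rcases ZMod.sq_eq_of_sixteen y with hy | hy | hy | hy <;>
  rcases ZMod.sq_eq_of_sixteen q with hq | hq | hq | hq <;>
  rw [hx, hy, hq] <;> decide

/-- There are no integers `q, a₂, a₃, b₂, b₃` satisfying `|a₂a₃ + b₂b₃| = 8` and
`a₂² + a₃² + b₂² + b₃² = 6(q² + 1)`. -/
theorem stmt10 :
    ¬ ∃ q a₂ a₃ b₂ b₃ : ℤ,
      |a₂ * a₃ + b₂ * b₃| = 8 ∧
      a₂ ^ 2 + a₃ ^ 2 + b₂ ^ 2 + b₃ ^ 2 = 6 * (q ^ 2 + 1) := by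
  rintro ⟨q, a₂, a₃, b₂, b₃, habs, hsum⟩
  have hdvd : (16 : ℤ) ∣ 2 * (a₂ * a₃ + b₂ * b₃) := by
    rcases eq_or_eq_neg_of_abs_eq habs with h | h <;> rw [h] <;> norm_num
  have hcross : ((2 * (a₂ * a₃ + b₂ * b₃) : ℤ) : ZMod 16) = 0 :=
    (ZMod.intCast_zmod_eq_zero_iff_dvd _ 16).2 hdvd
  have hsum' := congrArg (Int.cast : ℤ → ZMod 16) hsum
  push_cast at hcross hsum'
  refine ZMod.sq_add_sq_ne_six_mul_sq_add_one (a₂ + a₃ : ZMod 16) (b₂ + b₃) q ?_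
  linear_combination hsum' + hcross
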